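/- For n ≥ 3, define γ(n) = max{γ(D) : D a strongly connected simple directed graph on n vertices}. Then γ(n) = (2/3)·(n/(n−1) + (1/(n−1)!)·Σ_{i=1}^{n−3} i!)·(n−1)!, and a strongly connected simple directed graph D on n vertices satisfies γ(D) = γ(n) if and only if D is isomorphic to one of D₁, D₂, D₃, the directed graphs on vertices v_1,…,v_n with edge sets {(v_i,v_{i+1}) : 1 ≤ i ≤ n−1} ∪ {(v_j,v_i) : 1 ≤ i < j ≤ n−1} ∪ S, where S = {(v_n,v_1)} for D₁, S = {(v_n,v_2)} for D₂, and S = {(v_n,v_1),(v_n,v_2)} for D₃. Furthermore, lim_{n→∞} γ(n)/(n−1)! = 2/3. -/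

import Mathlib

namespace PR

/-- Out-degree of `u` in the digraph on vertex set `{1,…,n} ⊆ ℕ` with adjacency `E`. -/
def outDeg (n : ℕ) (E : ℕ → ℕ → Bool) (u : ℕ) : ℕ :=
  ((Finset.Icc 1 n).filter (fun v => E u v)).card

/-- In-degree of `u`. -/
def inDeg (n : ℕ) (E : ℕ → ℕ → Bool) (u : ℕ) : ℕ :=
  ((Finset.Icc 1 n).filter (fun v => E v u)).card

/-- `E` is a simple digraph on the vertex set `{1,…,n}`: all edges join distinct
vertices of `{1,…,n}` (no loops; the `Bool`-valued adjacency precludes multi-edges). -/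
def IsDigraph (n : ℕ) (E : ℕ → ℕ → Bool) : Prop :=
  ∀ u v, E u v = true → u ∈ Finset.Icc 1 n ∧ v ∈ Finset.Icc 1 n ∧ u ≠ v

/-- `WalkLen E k u v` : there is a directed walk of length `k` from `u` to `v`. -/
def WalkLen (E : ℕ → ℕ → Bool) : ℕ → ℕ → ℕ → Prop
  | 0, u, v => u = v
  | (k+1), u, v => ∃ w, E u w = true ∧ WalkLen E k w v

/-- Every vertex reaches every other vertex by a directed walk. -/
def StronglyConnected (n : ℕ) (E : ℕ → ℕ → Bool) : Prop :=
  ∀ u ∈ Finset.Icc 1 n, ∀ v ∈ Finset.Icc 1 n, ∃ k, WalkLen E k u v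

/-- Directed distance: number of edges in a shortest directed path from `u` to `v`. -/
noncomputable def dist (E : ℕ → ℕ → Bool) (u v : ℕ) : ℕ :=
  sInf {k | WalkLen E k u v}

/-- Distance between two sets of vertices. -/
noncomputable def setDist (E : ℕ → ℕ → Bool) (A B : Set ℕ) : ℕ :=
  sInf {k | ∃ a ∈ A, ∃ b ∈ B, dist E a b = k}

/-- `φ` is the Perron vector of the simple random walk on the digraph: a positive
probability distribution on `{1,…,n}` which is stationary, i.e. `φ P = φ` where
`P(u,v) = 1/d⁺(u)` for edges `(u,v)` and `0` otherwise. -/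
def IsPerron (n : ℕ) (E : ℕ → ℕ → Bool) (φ : ℕ → ℝ) : Prop :=
  (∀ v ∈ Finset.Icc 1 n, 0 < φ v) ∧
  (∑ v ∈ Finset.Icc 1 n, φ v = 1) ∧
  (∀ v ∈ Finset.Icc 1 n, φ v =
    ∑ u ∈ Finset.Icc 1 n, if E u v then φ u / (outDeg n E u : ℝ) else 0)

/-- The principal ratio `γ = (max_u φ(u)) / (min_u φ(u))` of a vector `φ` on `{1,…,n}`. -/
noncomputable def pratio (n : ℕ) (φ : ℕ → ℝ) : ℝ :=
  if h : (Finset.Icc 1 n).Nonempty then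
    ((Finset.Icc 1 n).sup' h φ) / ((Finset.Icc 1 n).inf' h φ)
  else 0

/-- Vertices attaining the maximum of `φ`. -/
def Vmax (n : ℕ) (φ : ℕ → ℝ) : Set ℕ :=
  {v | v ∈ Finset.Icc 1 n ∧ ∀ u ∈ Finset.Icc 1 n, φ u ≤ φ v}

/-- Vertices attaining the minimum of `φ`. -/
def Vmin (n : ℕ) (φ : ℕ → ℝ) : Set ℕ :=
  {v | v ∈ Finset.Icc 1 n ∧ ∀ u ∈ Finset.Icc 1 n, φ v ≤ φ u}

/-- The extremal graph `D₁`: path edges `(v_i,v_{i+1})` for `1 ≤ i ≤ n-1`, back edges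
`(v_j,v_i)` for `1 ≤ i < j ≤ n-1`, and the edge `(v_n,v_1)`. -/
def E1 (n : ℕ) : ℕ → ℕ → Bool := fun u v =>
  decide ((1 ≤ u ∧ u ≤ n - 1 ∧ v = u + 1) ∨ (1 ≤ v ∧ v < u ∧ u ≤ n - 1) ∨
    (u = n ∧ v = 1))

/-- The extremal graph `D₂`: as `D₁` but with `(v_n,v_2)` instead of `(v_n,v_1)`. -/
def E2 (n : ℕ) : ℕ → ℕ → Bool := fun u v =>
  decide ((1 ≤ u ∧ u ≤ n - 1 ∧ v = u + 1) ∨ (1 ≤ v ∧ v < u ∧ u ≤ n - 1) ∨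
    (u = n ∧ v = 2))

/-- The extremal graph `D₃`: as `D₁` but with both edges `(v_n,v_1)` and `(v_n,v_2)`. -/
def E3 (n : ℕ) : ℕ → ℕ → Bool := fun u v =>
  decide ((1 ≤ u ∧ u ≤ n - 1 ∧ v = u + 1) ∨ (1 ≤ v ∧ v < u ∧ u ≤ n - 1) ∨
    (u = n ∧ (v = 1 ∨ v = 2)))

/-- Isomorphism of digraphs on the vertex set `{1,…,n}`. -/
def IsoTo (n : ℕ) (E E' : ℕ → ℕ → Bool) : Prop :=
  ∃ σ : ℕ → ℕ,
    Set.BijOn σ (Finset.Icc 1 n : Set ℕ) (Finset.Icc 1 n : Set ℕ) ∧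
    ∀ u ∈ Finset.Icc 1 n, ∀ v ∈ Finset.Icc 1 n,
      (E u v = true ↔ E' (σ u) (σ v) = true)

/-- `γ(n)`: the maximum principal ratio over all strongly connected simple
digraphs on `n` vertices. -/
noncomputable def gammaN (n : ℕ) : ℝ :=
  sSup {r : ℝ | ∃ E : ℕ → ℕ → Bool, ∃ φ : ℕ → ℝ,
    IsDigraph n E ∧ StronglyConnected n E ∧ IsPerron n E φ ∧ r = pratio n φ}

/-- If a signed sum over the chosen indices vanishes, one chosen negative term is controlled by
the total of the nonnegative values on `L`. -/
theorem neg_le_sum_of_balanced {s L : Finset ℕ} (hLs : L ⊆ s) {B : ℕ → Bool} {f : ℕ → ℝ}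
    (hbal : ∑ v ∈ s, (if B v then f v else 0) = 0) (hL : ∀ v ∈ L, 0 ≤ f v)
    (hneg : ∀ v ∈ s, v ∉ L → B v → f v ≤ 0) {l : ℕ} (hl : l ∈ s) (hlL : l ∉ L) (hB : B l) :
    -f l ≤ ∑ v ∈ L, f v ∧
      (-f l = ∑ v ∈ L, f v →
        (∀ v ∈ L, 0 < f v → B v) ∧ ∀ v ∈ s, v ∉ L → v ≠ l → B v → f v = 0) := by
  set d : ℕ → ℝ := fun v => (if v ∈ L then f v else 0) - (if B v then f v else 0) with hd
  have hd0 : ∀ v ∈ s, 0 ≤ d v := by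
    intro v hv
    by_cases h1 : v ∈ L <;> by_cases h2 : B v = true <;> simp [hd, h1, h2]
    · exact hL v h1
    · exact hneg v hv h1 h2
  have hsum : ∑ v ∈ s, d v = ∑ v ∈ L, f v := by
    rw [Finset.sum_sub_distrib, hbal, sub_zero, Finset.sum_ite_mem,
      Finset.inter_eq_right.mpr hLs]
  have hdl : d l = -f l := by simp [hd, hlL, hB]
  refine ⟨by rw [← hdl, ← hsum]; exact Finset.single_le_sum hd0 hl, fun heq => ?_⟩
  have herase : ∑ v ∈ s.erase l, d v = 0 := by
    have := Finset.add_sum_erase s d hl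
    linarith
  have hz := (Finset.sum_eq_zero_iff_of_nonneg
    (fun v hv => hd0 v (Finset.mem_of_mem_erase hv))).mp herase
  constructor
  · intro v hv hpos
    have hvl : v ≠ l := fun h => hlL (h ▸ hv)
    have := hz v (Finset.mem_erase.mpr ⟨hvl, hLs hv⟩)
    by_contra hB'
    simp [hd, hv, hB'] at this
    exact hpos.ne' this
  · intro v hv hvL hvl hBv
    have := hz v (Finset.mem_erase.mpr ⟨hvl, hv⟩)
    simpa [hd, hvL, hBv] using this

/-- The factorial sum `1! + 2! + ⋯ + N!`. -/
noncomputable def factSum (N : ℕ) : ℝ := ∑ i ∈ Finset.Icc 1 N, (Nat.factorial i : ℝ)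

theorem factSum_succ (N : ℕ) : factSum (N + 1) = factSum N + (Nat.factorial (N + 1) : ℝ) := by
  rw [factSum, factSum, Finset.sum_Icc_succ_top (by omega)]

theorem factSum_two : factSum 2 = 3 := by
  norm_num [factSum, Finset.sum_Icc_succ_top, Nat.factorial]

theorem factSum_lt_succ (N : ℕ) : factSum N < factSum (N + 1) := by
  rw [factSum_succ]
  have : (0 : ℝ) < Nat.factorial (N + 1) := by positivity
  linarith

theorem factSum_strictMono : StrictMono factSum := strictMono_nat_of_lt_succ factSum_lt_succ

/-- For `k ≥ 3`, `k < (2/3)(1! + ⋯ + k!)` and `k² ≤ (2/3)(k+1)!`. -/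
theorem lt_factSum_of_three_le {k : ℕ} (hk : 3 ≤ k) :
    (k : ℝ) < 2 / 3 * factSum k ∧ (k : ℝ) ^ 2 ≤ 2 / 3 * (Nat.factorial (k + 1) : ℝ) := by
  induction k, hk using Nat.le_induction with
  | base =>
    norm_num [factSum, Finset.sum_Icc_succ_top, Nat.factorial]
  | succ k hk ih =>
    have hk' : (3 : ℝ) ≤ k := by exact_mod_cast hk
    rw [factSum_succ, Nat.factorial_succ (k + 1)]
    push_cast
    constructor <;> nlinarith [ih.1, ih.2]

/-- Total gap between `x j` and the earlier values. -/
noncomputable def excess (x : ℕ → ℝ) (j : ℕ) : ℝ := ∑ s ∈ Finset.range j, (x j - x s)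

theorem excess_succ (x : ℕ → ℝ) (j : ℕ) :
    excess x (j + 1) = excess x j + (j + 1) * (x (j + 1) - x j) := by
  simp only [excess, Finset.sum_sub_distrib, Finset.sum_const, Finset.card_range, nsmul_eq_mul,
    Finset.sum_range_succ]
  push_cast
  ring

/-- Sorted harmonic profile of a digraph on `{0,…,N}`: `x` vanishes at the source `0`, is harmonic
at the inner vertices, and has average `p` over the out-neighbours of the source. -/
structure Profile (N : ℕ) (A : ℕ → ℕ → Bool) (x : ℕ → ℝ) (p : ℝ) : Prop where
  mono : ∀ i j, i ≤ j → j ≤ N → x i ≤ x j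
  zero : x 0 = 0
  irrefl : ∀ i, A i i = false
  harm : ∀ i, 0 < i → i < N →
    ∑ v ∈ Finset.range (N + 1), (if A i v then x i - x v else 0) = 0
  source : ∑ v ∈ Finset.range (N + 1), (if A 0 v then p - x v else 0) = 0
  cross : ∀ j, 1 ≤ j → j ≤ N → ∃ i < j, ∃ l, j ≤ l ∧ l ≤ N ∧ A i l = true

namespace Profile

variable {N : ℕ} {A : ℕ → ℕ → Bool} {x : ℕ → ℝ} {p : ℝ}

theorem nonneg (H : Profile N A x p) {i : ℕ} (hi : i ≤ N) : 0 ≤ x i :=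
  H.zero ▸ H.mono 0 i (Nat.zero_le _) hi

theorem excess_mono (H : Profile N A x p) {i j : ℕ} (hij : i ≤ j) (hj : j ≤ N) :
    excess x i ≤ excess x j := by
  unfold excess
  refine (Finset.sum_le_sum fun s _ => sub_le_sub_right (H.mono i j hij hj) _).trans
    (Finset.sum_le_sum_of_subset_of_nonneg (Finset.range_mono hij) fun s hs _ => ?_)
  exact sub_nonneg.mpr (H.mono s j (Finset.mem_range.mp hs).le hj)

theorem excess_le (H : Profile N A x p) {j : ℕ} (hj : j ≤ N) : excess x j ≤ j * x j := by
  unfold excess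
  refine (Finset.sum_le_sum fun s hs => sub_le_self (x j)
    (H.nonneg ((Finset.mem_range.mp hs).le.trans hj))).trans ?_
  simp

/-- An edge leaving an inner vertex upwards raises the profile by at most the excess. -/
theorem le_add_excess (H : Profile N A x p) {i l : ℕ} (hi : 0 < i) (hil : i < l) (hl : l ≤ N)
    (hA : A i l) :
    x l ≤ x i + excess x i ∧ (x l = x i + excess x i →
      (∀ v < i, x v < x i → A i v) ∧ ∀ v, i ≤ v → v ≤ N → v ≠ l → A i v → x v = x i) := by
  have key := neg_le_sum_of_balanced (s := Finset.range (N + 1)) (L := Finset.range i)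
    (B := A i) (f := fun v => x i - x v) (Finset.range_mono (by omega))
    (H.harm i hi (by omega))
    (fun v hv => sub_nonneg.mpr (H.mono v i (Finset.mem_range.mp hv).le (by omega)))
    (fun v hv hv' _ => by
      simp only [Finset.mem_range] at hv hv'
      exact sub_nonpos.mpr (H.mono i v (by omega) (by omega)))
    (l := l) (by simp; omega) (by simp; omega) hA
  refine ⟨by have := key.1; unfold excess; linarith, fun h => ?_⟩
  obtain ⟨h1, h2⟩ := key.2 (by unfold excess at h; linarith)
  refine ⟨fun v hv hx => h1 v (by simpa using hv) (sub_pos.mpr hx), fun v hiv hv hvl hAv => ?_⟩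
  have := h2 v (by simp; omega) (by simp; omega) hvl hAv
  linarith

/-- The analogue of `le_add_excess` at the source. -/
theorem le_source (H : Profile N A x p) {k l : ℕ} (hlow : ∀ s, 1 ≤ s → s < k → x s < p)
    (hk : p ≤ x k) (hkl : k ≤ l) (hl : l ≤ N) (hA : A 0 l) :
    x l ≤ p + ∑ s ∈ Finset.Ico 1 k, (p - x s) ∧ (x l = p + ∑ s ∈ Finset.Ico 1 k, (p - x s) →
      (∀ v, 1 ≤ v → v < k → A 0 v) ∧ ∀ v, k ≤ v → v ≤ N → v ≠ l → A 0 v → x v = p) := by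
  have key := neg_le_sum_of_balanced (s := Finset.range (N + 1)) (L := Finset.Ico 1 k)
    (B := A 0) (f := fun v => p - x v)
    (fun v hv => by simp at hv ⊢; omega) H.source
    (fun v hv => by
      simp only [Finset.mem_Ico] at hv
      exact (sub_pos.mpr (hlow v hv.1 hv.2)).le)
    (fun v hv hv' hB => by
      simp only [Finset.mem_range, Finset.mem_Ico] at hv hv'
      have hv0 : v ≠ 0 := by
        rintro rfl
        simp [H.irrefl] at hB
      exact sub_nonpos.mpr (hk.trans (H.mono k v (by omega) (by omega))))
    (l := l) (by simp; omega) (by simp; omega) hA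
  refine ⟨by linarith [key.1], fun h => ?_⟩
  obtain ⟨h1, h2⟩ := key.2 (by linarith)
  refine ⟨fun v hv hvk => h1 v (by simp; omega) (sub_pos.mpr (hlow v hv hvk)),
    fun v hkv hv hvl hAv => ?_⟩
  have := h2 v (by simp; omega) (by simp; omega) hvl hAv
  linarith

theorem exists_source_edge (H : Profile N A x p) (hN : 1 ≤ N) :
    ∃ l, 1 ≤ l ∧ l ≤ N ∧ A 0 l = true := by
  obtain ⟨i, hi, l, h1, h2, h3⟩ := H.cross 1 le_rfl hN
  obtain rfl : i = 0 := by omega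
  exact ⟨l, h1, h2, h3⟩

/-- The first index at which the profile reaches the source average. -/
theorem exists_first (H : Profile N A x p) (hN : 1 ≤ N) :
    ∃ k, 1 ≤ k ∧ k ≤ N ∧ p ≤ x k ∧ ∀ s, 1 ≤ s → s < k → x s < p := by
  classical
  have hex : ∃ k, 1 ≤ k ∧ k ≤ N ∧ p ≤ x k := by
    by_contra! hcon
    obtain ⟨l, hl1, hlN, hl⟩ := H.exists_source_edge hN
    have : 0 < ∑ v ∈ Finset.range (N + 1), (if A 0 v then p - x v else 0) := by
      refine Finset.sum_pos' (fun v hv => ?_) ⟨l, by simp; omega, ?_⟩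
      · split_ifs with hA
        · have hv0 : v ≠ 0 := by
            rintro rfl
            simp [H.irrefl] at hA
          have := hcon v (by omega) (by simp at hv; omega)
          linarith
        · exact le_rfl
      · rw [if_pos hl]
        linarith [hcon l hl1 hlN]
    exact this.ne' H.source
  refine ⟨Nat.find hex, (Nat.find_spec hex).1, (Nat.find_spec hex).2.1,
    (Nat.find_spec hex).2.2, fun s hs hsk => ?_⟩
  have := Nat.find_min hex hsk
  push Not at this
  exact this hs (by have := (Nat.find_spec hex).2.1; omega)

theorem source_nonneg (H : Profile N A x p) (hN : 1 ≤ N) : 0 ≤ p := by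
  by_contra! hp
  obtain ⟨l, hl1, hlN, hl⟩ := H.exists_source_edge hN
  have : 0 < ∑ v ∈ Finset.range (N + 1), -(if A 0 v then p - x v else 0) := by
    refine Finset.sum_pos' (fun v hv => ?_) ⟨l, by simp; omega, ?_⟩
    · split_ifs with hA
      · linarith [H.nonneg (i := v) (by simp at hv; omega)]
      · simp
    · rw [if_pos hl]
      linarith [H.nonneg hlN]
  rw [Finset.sum_neg_distrib, H.source] at this
  simp at this

/-- Values at the first index above the source average. -/
theorem first_le (H : Profile N A x p) {k : ℕ} (hk1 : 1 ≤ k) (hkN : k ≤ N) (hk : p ≤ x k)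
    (hlow : ∀ s, 1 ≤ s → s < k → x s < p) : x k ≤ k * p := by
  have hp := H.source_nonneg (hk1.trans hkN)
  obtain ⟨i, hik, l, hkl, hlN, hA⟩ := H.cross k hk1 hkN
  refine (H.mono k l hkl hlN).trans ?_
  rcases Nat.eq_zero_or_pos i with rfl | hi
  · refine (H.le_source hlow hk hkl hlN hA).1.trans ?_
    have : ∑ s ∈ Finset.Ico 1 k, (p - x s) ≤ ∑ s ∈ Finset.Ico 1 k, p :=
      Finset.sum_le_sum fun s hs => by
        simp only [Finset.mem_Ico] at hs
        linarith [H.nonneg (i := s) (by omega)]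
    simp only [Finset.sum_const, Nat.card_Ico, nsmul_eq_mul, Nat.cast_sub hk1] at this
    push_cast at this
    linarith
  · have h1 := (H.le_add_excess hi (by omega) hlN hA).1
    have h2 := H.excess_le (j := i) (by omega)
    have h3 := hlow i hi hik
    have h4 : ((i + 1 : ℕ) : ℝ) ≤ k := by exact_mod_cast hik
    push_cast at h4
    nlinarith [H.nonneg (i := i) (by omega)]

/-- Growth of the profile above the source average. -/
theorem step_le (H : Profile N A x p) {k j : ℕ} (hk : p ≤ x k)
    (hlow : ∀ s, 1 ≤ s → s < k → x s < p) (hkj : k ≤ j) (hj : j + 1 ≤ N) :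
    x (j + 1) ≤ x j + excess x j := by
  obtain ⟨i, hij, l, hjl, hlN, hA⟩ := H.cross (j + 1) (by omega) hj
  refine (H.mono (j + 1) l hjl hlN).trans ?_
  rcases Nat.eq_zero_or_pos i with rfl | hi
  · refine (H.le_source hlow hk (by omega) hlN hA).1.trans ?_
    have hpj : p ≤ x j := hk.trans (H.mono k j hkj (by omega))
    refine add_le_add hpj ?_
    refine (Finset.sum_le_sum fun s _ => sub_le_sub_right hpj _).trans
      (Finset.sum_le_sum_of_subset_of_nonneg (fun s hs => ?_) fun s hs _ => ?_)
    · simp at hs ⊢; omega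
    · exact sub_nonneg.mpr (H.mono s j (Finset.mem_range.mp hs).le (by omega))
  · exact (H.le_add_excess hi (by omega) hlN hA).1.trans
      (add_le_add (H.mono i j (by omega) (by omega)) (H.excess_mono (by omega) (by omega)))

theorem excess_step_le (H : Profile N A x p) {k j : ℕ} (hk : p ≤ x k)
    (hlow : ∀ s, 1 ≤ s → s < k → x s < p) (hkj : k ≤ j) (hj : j + 1 ≤ N) :
    excess x (j + 1) ≤ (j + 2) * excess x j := by
  rw [excess_succ]
  have := H.step_le hk hlow hkj hj
  nlinarith [(Nat.cast_nonneg j : (0 : ℝ) ≤ j)]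

/-- Base case of the factorial growth bound. -/
theorem base_le (H : Profile N A x p) (hN : 2 ≤ N) {k : ℕ} (hk1 : 1 ≤ k) (hkN : k ≤ N)
    (hk : p ≤ x k) (hlow : ∀ s, 1 ≤ s → s < k → x s < p) :
    x (max k 2) ≤ 2 / 3 * factSum (max k 2) * p ∧
      excess x (max k 2) ≤ 2 / 3 * (Nat.factorial (max k 2 + 1) : ℝ) * p := by
  have hp := H.source_nonneg (hk1.trans hkN)
  have hx := H.first_le hk1 hkN hk hlow
  have he := H.excess_le hkN
  rcases lt_trichotomy k 2 with h | rfl | h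
  · obtain rfl : k = 1 := by omega
    have h1 := H.step_le hk hlow le_rfl hN
    have h2 := H.excess_step_le hk hlow le_rfl hN
    norm_num [factSum_two, Nat.factorial] at *
    constructor <;> linarith
  · norm_num [factSum_two, Nat.factorial] at *
    constructor <;> linarith
  · rw [max_eq_left h.le]
    obtain ⟨h1, h2⟩ := lt_factSum_of_three_le h
    constructor
    · nlinarith
    · have hk0 : (0 : ℝ) ≤ k := Nat.cast_nonneg k
      nlinarith [mul_le_mul_of_nonneg_left hx hk0, mul_le_mul_of_nonneg_right h2 hp]

theorem growth_le (H : Profile N A x p) (hN : 2 ≤ N) {k : ℕ} (hk1 : 1 ≤ k) (hkN : k ≤ N)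
    (hk : p ≤ x k) (hlow : ∀ s, 1 ≤ s → s < k → x s < p) {j : ℕ} (hj : max k 2 ≤ j)
    (hjN : j ≤ N) :
    x j ≤ 2 / 3 * factSum j * p ∧ excess x j ≤ 2 / 3 * (Nat.factorial (j + 1) : ℝ) * p := by
  induction j, hj using Nat.le_induction with
  | base => exact H.base_le hN hk1 hkN hk hlow
  | succ j hj ih =>
    obtain ⟨ih1, ih2⟩ := ih (by omega)
    have hkj : k ≤ j := (le_max_left _ _).trans hj
    have h1 := H.step_le hk hlow hkj hjN
    have h2 := H.excess_step_le hk hlow hkj hjN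
    refine ⟨by rw [factSum_succ]; linarith, ?_⟩
    rw [Nat.factorial_succ (j + 1)]
    push_cast
    nlinarith [(Nat.cast_nonneg j : (0 : ℝ) ≤ j)]

theorem top_le (H : Profile N A x p) (hN : 2 ≤ N) : x N ≤ 2 / 3 * factSum N * p := by
  obtain ⟨k, hk1, hkN, hk, hlow⟩ := H.exists_first (by omega)
  exact (H.growth_le hN hk1 hkN hk hlow (by simp; omega) le_rfl).1

/-- Equality at the top propagates down to every level of the growth bound. -/
theorem eq_of_top_eq (H : Profile N A x p) (hN : 2 ≤ N) {k : ℕ} (hk1 : 1 ≤ k) (hkN : k ≤ N)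
    (hk : p ≤ x k) (hlow : ∀ s, 1 ≤ s → s < k → x s < p) (htop : x N = 2 / 3 * factSum N * p)
    {j : ℕ} (hj : max k 2 ≤ j) (hjN : j ≤ N) :
    x j = 2 / 3 * factSum j * p ∧
      (j < N → excess x j = 2 / 3 * (Nat.factorial (j + 1) : ℝ) * p) := by
  induction hd : N - j generalizing j with
  | zero =>
    obtain rfl : j = N := by omega
    exact ⟨htop, fun h => absurd h (lt_irrefl _)⟩
  | succ d ih =>
    have h1 := (ih (j := j + 1) (by omega) (by omega) (by omega)).1
    have h2 := H.growth_le hN hk1 hkN hk hlow hj hjN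
    have h3 := H.step_le hk hlow ((le_max_left _ _).trans hj) (show j + 1 ≤ N by omega)
    rw [h1, factSum_succ] at h3
    exact ⟨by linarith, fun _ => by linarith⟩

/-- In the equality case either the profile first exceeds the source average at index `2`, or
there are only three vertices. -/
theorem first_of_top_eq (H : Profile N A x p) (hN : 2 ≤ N) (hp : 0 < p)
    {k : ℕ} (hk1 : 1 ≤ k) (hkN : k ≤ N) (hk : p ≤ x k) (hlow : ∀ s, 1 ≤ s → s < k → x s < p)
    (htop : x N = 2 / 3 * factSum N * p) : k = 2 ∨ k = 1 ∧ N = 2 := by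
  have hmax : max k 2 ≤ N := by simp; omega
  obtain ⟨h1, h2⟩ := H.eq_of_top_eq hN hk1 hkN hk hlow htop le_rfl hmax
  have hx := H.first_le hk1 hkN hk hlow
  rcases lt_trichotomy k 2 with h | rfl | h
  · obtain rfl : k = 1 := by omega
    refine Or.inr ⟨rfl, ?_⟩
    by_contra hN2
    have he := H.excess_le hkN
    have h3 := H.excess_step_le hk hlow le_rfl hN
    have h4 := h2 (by simp; omega)
    norm_num [Nat.factorial] at *
    linarith
  · exact Or.inl rfl
  · rw [max_eq_left h.le] at h1
    have := (lt_factSum_of_three_le h).1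
    nlinarith

/-- A three-vertex profile exceeding the source average at once. -/
theorem edges_of_first_one (H : Profile 2 A x p) (hp : 0 < p) (hk : p ≤ x 1)
    (htop : x 2 = 2 / 3 * factSum 2 * p) :
    (∀ v ≤ 2, (A 0 v = true ↔ v = 1)) ∧ ∀ v ≤ 2, (A 1 v = true ↔ v = 0 ∨ v = 2) := by
  have hx := H.first_le le_rfl one_le_two hk (fun s h1 h2 => by omega)
  have hs := H.source
  have hh := H.harm 1 one_pos one_lt_two
  have h0 := H.irrefl 0
  have h1 := H.irrefl 1
  obtain ⟨i, hi, l, hl, hl2, hA⟩ := H.cross 2 one_le_two le_rfl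
  obtain rfl : l = 2 := by omega
  norm_num [factSum_two] at htop hx
  have hx1 : x 1 = p := le_antisymm hx hk
  simp only [Finset.sum_range_succ, Finset.sum_range_zero, H.zero, h0, h1, hx1, htop] at hs hh
  have h02 : A 0 2 = false := by
    by_contra hc
    rw [Bool.not_eq_false] at hc
    simp [hc] at hs
    linarith
  have hi1 : i = 1 := by
    have : i ≠ 0 := by
      rintro rfl
      simp [h02] at hA
    omega
  subst hi1
  obtain ⟨l, hl1, hlN, hl⟩ := H.exists_source_edge one_le_two
  have hl' : l = 1 := by
    have : l ≠ 2 := by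
      rintro rfl
      simp [h02] at hl
    omega
  subst hl'
  have h10 : A 1 0 = true := by
    by_contra hc
    simp [hc, hA] at hh
    linarith
  constructor <;> intro v hv <;> interval_cases v <;> simp [*]

/-- Edges of an extremal profile. -/
theorem edges_of_first_two (H : Profile N A x p) (hN : 2 ≤ N) (hp : 0 < p) (hx1 : x 1 < p)
    (hk : p ≤ x 2) (htop : x N = 2 / 3 * factSum N * p) (hout : ∃ v ≤ N, A 1 v = true) :
    x 1 = 0 ∧ (∀ v, 2 ≤ v → v ≤ N → 0 < x v) ∧
      (∀ v ≤ N, (A 0 v = true ↔ v = 1 ∨ v = 2)) ∧ (∀ v ≤ N, (A 1 v = true ↔ v = 0)) ∧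
      ∀ i, 2 ≤ i → i < N → ∀ v ≤ N, (A i v = true ↔ v < i ∨ v = i + 1) := by
  have hlow : ∀ s, 1 ≤ s → s < 2 → x s < p := by
    intro s h1 h2
    obtain rfl : s = 1 := by omega
    exact hx1
  have heq : ∀ j, 2 ≤ j → j ≤ N → x j = 2 / 3 * factSum j * p ∧
      (j < N → excess x j = 2 / 3 * (Nat.factorial (j + 1) : ℝ) * p) := fun j h1 h2 =>
    H.eq_of_top_eq hN one_le_two hN hk hlow htop (by simpa using h1) h2
  have hstrict : ∀ i j, 2 ≤ i → i < j → j ≤ N → x i < x j := by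
    intro i j h1 h2 h3
    rw [(heq i h1 (by omega)).1, (heq j (by omega) h3).1]
    have := factSum_strictMono h2
    nlinarith
  have hx2 : x 2 = 2 * p := by rw [(heq 2 le_rfl hN).1, factSum_two]; ring
  have hge : ∀ v, 2 ≤ v → v ≤ N → 2 * p ≤ x v := fun v h1 h2 => hx2 ▸ H.mono 2 v h1 h2
  have hpos : ∀ v, 2 ≤ v → v ≤ N → 0 < x v := fun v h1 h2 => by linarith [hge v h1 h2]
  obtain ⟨hx10, h0⟩ : x 1 = 0 ∧ ∀ v ≤ N, (A 0 v = true ↔ v = 1 ∨ v = 2) := by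
    obtain ⟨i, hi, l, hl, hlN, hA⟩ := H.cross 2 one_le_two hN
    have hi0 : i = 0 := by
      by_contra hi0
      obtain rfl : i = 1 := by omega
      have := (H.le_add_excess one_pos (by omega) hlN hA).1
      simp only [excess, Finset.sum_range_one, H.zero] at this
      linarith [hge l hl hlN]
    subst hi0
    obtain ⟨h1, h2⟩ := H.le_source hlow hk hl hlN hA
    have hIco : ∑ s ∈ Finset.Ico 1 2, (p - x s) = p - x 1 := by simp
    rw [hIco] at h1 h2
    have h3 := H.nonneg (i := 1) (by omega)
    have h4 := hge l hl hlN
    have hl2 : l = 2 := by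
      by_contra hne
      linarith [hstrict 2 l le_rfl (by omega) hlN]
    subst hl2
    obtain ⟨h5, h6⟩ := h2 (by linarith)
    refine ⟨by linarith, fun v hv => ⟨fun hAv => ?_, ?_⟩⟩
    · by_contra! hne
      have hv0 : v ≠ 0 := by
        rintro rfl
        simp [H.irrefl] at hAv
      linarith [h6 v (by omega) hv hne.2 hAv, hge v (by omega) hv]
    · rintro (rfl | rfl)
      · exact h5 1 le_rfl one_lt_two
      · exact hA
  have h1 : ∀ v ≤ N, (A 1 v = true ↔ v = 0) := by
    have hsub : ∀ v ≤ N, A 1 v = true → v = 0 := by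
      intro v hv hAv
      have hz := H.harm 1 one_pos (by omega)
      rw [Finset.sum_eq_zero_iff_of_nonpos (fun w hw => by
        split_ifs
        · rw [hx10, zero_sub]
          exact neg_nonpos.mpr (H.nonneg (by simp at hw; omega))
        · exact le_rfl)] at hz
      have := hz v (by simp; omega)
      rw [if_pos hAv, hx10] at this
      have hv1 : v ≠ 1 := by
        rintro rfl
        simp [H.irrefl] at hAv
      by_contra hv0
      linarith [hpos v (by omega) hv]
    refine fun v hv => ⟨hsub v hv, ?_⟩
    rintro rfl
    obtain ⟨u, hu, hAu⟩ := hout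
    exact hsub u hu hAu ▸ hAu
  have hexc : ∀ i, 2 ≤ i → i < N → x i + excess x i = x (i + 1) := by
    intro i hi hiN
    rw [(heq i hi hiN.le).1, (heq i hi hiN.le).2 hiN, (heq (i + 1) (by omega) hiN).1,
      factSum_succ]
    ring
  refine ⟨hx10, hpos, h0, h1, fun i hi hiN v hv => ?_⟩
  obtain ⟨i', hi', l, hl, hlN, hA⟩ := H.cross (i + 1) (by omega) hiN
  have hi0 : i' ≠ 0 := by
    rintro rfl
    have := (h0 l hlN).mp hA
    omega
  have hi1 : i' ≠ 1 := by
    rintro rfl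
    have := (h1 l hlN).mp hA
    omega
  obtain ⟨hle, hrig⟩ := H.le_add_excess (by omega) (by omega) hlN hA
  rw [hexc i' (by omega) (by omega)] at hle hrig
  have hl' : l = i' + 1 := by
    by_contra hne
    linarith [hstrict (i' + 1) l (by omega) (by omega) hlN]
  obtain rfl : i' = i := by omega
  subst hl'
  obtain ⟨hr1, hr2⟩ := hrig rfl
  constructor
  · intro hAv
    by_contra! hne
    have hvi : v ≠ i' := by
      rintro rfl
      simp [H.irrefl] at hAv
    linarith [hr2 v hne.1 hv hne.2 hAv, hstrict i' v hi (by omega) hv]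
  · rintro (hvi | rfl)
    · refine hr1 v hvi ?_
      rcases Nat.lt_or_ge v 2 with hv2 | hv2
      · have : x v = 0 := by
          interval_cases v
          · exact H.zero
          · exact hx10
        rw [this]
        exact hpos i' hi hiN.le
      · exact hstrict v i' hv2 hvi hiN.le
    · exact hA

end Profile

section Harmonic

variable {V : Type*} [Fintype V]

/-- Minimum principle for functions harmonic off `{a, b}`. -/
theorem le_of_harmonic {A : V → V → Bool} {a b : V}
    (hreach : ∀ u, Relation.ReflTransGen (fun u v => A u v = true) u a) {f : V → ℝ}
    (hf : ∀ u, u ≠ a → u ≠ b → ∑ v, (if A u v then f v - f u else 0) = 0) {m : ℝ}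
    (ha : m ≤ f a) (hb : m ≤ f b) (u : V) : m ≤ f u := by
  have : Nonempty V := ⟨a⟩
  obtain ⟨u₀, hu₀⟩ := Finite.exists_min f
  suffices h : ∀ w, f w = f u₀ → m ≤ f u₀ from (h u₀ rfl).trans (hu₀ u)
  intro w
  induction hreach w using Relation.ReflTransGen.head_induction_on with
  | refl => exact fun h => h ▸ ha
  | @head w c hwc _ ih =>
    intro hw
    by_cases hwa : w = a
    · exact hw ▸ hwa ▸ ha
    by_cases hwb : w = b
    · exact hw ▸ hwb ▸ hb
    have hz := hf w hwa hwb
    rw [Finset.sum_eq_zero_iff_of_nonneg (fun v _ => by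
      split_ifs
      · exact sub_nonneg.mpr (hw ▸ hu₀ v)
      · exact le_rfl)] at hz
    have := hz c (Finset.mem_univ c)
    rw [if_pos hwc] at this
    exact ih (by linarith)

/-- Maximum principle for functions harmonic off `{a, b}`. -/
theorem harmonic_le {A : V → V → Bool} {a b : V}
    (hreach : ∀ u, Relation.ReflTransGen (fun u v => A u v = true) u a) {f : V → ℝ}
    (hf : ∀ u, u ≠ a → u ≠ b → ∑ v, (if A u v then f v - f u else 0) = 0) {m : ℝ}
    (ha : f a ≤ m) (hb : f b ≤ m) (u : V) : f u ≤ m := by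
  have := le_of_harmonic hreach (f := fun u => -f u) (a := a) (b := b) (m := -m)
    (fun w h1 h2 => by
      rw [← neg_eq_zero, ← Finset.sum_neg_distrib]
      refine Eq.trans (Finset.sum_congr rfl fun v _ => ?_) (hf w h1 h2)
      split_ifs <;> ring) (neg_le_neg ha) (neg_le_neg hb) u
  exact neg_le_neg_iff.mp this

/-- The Dirichlet problem with boundary values `0` at `a` and `1` at `b`. -/
theorem exists_harmonic {A : V → V → Bool} {a b : V} (hab : a ≠ b)
    (hreach : ∀ u, Relation.ReflTransGen (fun u v => A u v = true) u a) :
    ∃ h : V → ℝ, h a = 0 ∧ h b = 1 ∧ (∀ u, 0 ≤ h u ∧ h u ≤ 1) ∧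
      ∀ u, u ≠ a → u ≠ b → ∑ v, (if A u v then h v - h u else 0) = 0 := by
  classical
  let T : (V → ℝ) →ₗ[ℝ] (V → ℝ) :=
    { toFun := fun f u => if u = a ∨ u = b then f u else ∑ v, (if A u v then f v - f u else 0)
      map_add' := fun f g => by
        funext u
        simp only [Pi.add_apply]
        split_ifs
        · rfl
        · rw [← Finset.sum_add_distrib]
          refine Finset.sum_congr rfl fun v _ => ?_
          split_ifs <;> ring
      map_smul' := fun c f => by
        funext u
        simp only [Pi.smul_apply, smul_eq_mul, RingHom.id_apply]
        split_ifs
        · rfl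
        · rw [Finset.mul_sum]
          refine Finset.sum_congr rfl fun v _ => ?_
          split_ifs <;> ring }
  have hT : ∀ f u, T f u =
      if u = a ∨ u = b then f u else ∑ v, (if A u v then f v - f u else 0) := fun _ _ => rfl
  have hinj : Function.Injective T := by
    rw [injective_iff_map_eq_zero]
    intro f hf
    have hfu : ∀ u, (if u = a ∨ u = b then f u else
        ∑ v, (if A u v then f v - f u else 0)) = 0 := fun u => by
      rw [← hT, hf]; rfl
    have ha : f a = 0 := by simpa using hfu a
    have hb : f b = 0 := by simpa using hfu b
    have hharm : ∀ u, u ≠ a → u ≠ b → ∑ v, (if A u v then f v - f u else 0) = 0 :=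
      fun u h1 h2 => by simpa [h1, h2] using hfu u
    funext u
    exact le_antisymm (harmonic_le hreach hharm ha.le hb.le u)
      (le_of_harmonic hreach hharm ha.ge hb.ge u)
  obtain ⟨h, hh⟩ := (LinearMap.injective_iff_surjective.mp hinj) (fun u => if u = b then 1 else 0)
  have hhu : ∀ u, (if u = a ∨ u = b then h u else
      ∑ v, (if A u v then h v - h u else 0)) = if u = b then 1 else 0 := fun u => by
    rw [← hT, hh]
  have ha : h a = 0 := by simpa [hab] using hhu a
  have hb : h b = 1 := by simpa using hhu b
  have hharm : ∀ u, u ≠ a → u ≠ b → ∑ v, (if A u v then h v - h u else 0) = 0 :=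
    fun u h1 h2 => by simpa [h1, h2] using hhu u
  exact ⟨h, ha, hb, fun u => ⟨le_of_harmonic hreach hharm ha.ge (by simp [hb]) u,
    harmonic_le hreach hharm (by simp [ha]) hb.le u⟩, hharm⟩

/-- An irreducible stochastic matrix has a positive stationary distribution. -/
theorem exists_stationary [Nonempty V] {P : Matrix V V ℝ} (hP : ∀ u v, 0 ≤ P u v)
    (hrow : ∀ u, ∑ v, P u v = 1)
    (hirr : ∀ u v, Relation.ReflTransGen (fun u v => 0 < P u v) u v) :
    ∃ φ : V → ℝ, (∀ v, 0 < φ v) ∧ ∑ v, φ v = 1 ∧ ∀ v, φ v = ∑ u, φ u * P u v := by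
  classical
  have hdet : (P - 1).det = 0 := by
    rw [← Matrix.exists_mulVec_eq_zero_iff]
    refine ⟨fun _ => 1, fun h => one_ne_zero (congrFun h (Classical.arbitrary V)), ?_⟩
    rw [Matrix.sub_mulVec, Matrix.one_mulVec]
    funext u
    simp [Matrix.mulVec, dotProduct, hrow]
  obtain ⟨ψ, hψ0, hψ⟩ := Matrix.exists_vecMul_eq_zero_iff.mpr hdet
  have hstat : ∀ v, ψ v = ∑ u, ψ u * P u v := by
    intro v
    rw [Matrix.vecMul_sub, Matrix.vecMul_one, sub_eq_zero] at hψ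
    exact (congrFun hψ v).symm
  have hle : ∀ v ∈ Finset.univ, |ψ v| ≤ ∑ u, |ψ u| * P u v := by
    intro v _
    conv_lhs => rw [hstat v]
    refine (Finset.abs_sum_le_sum_abs _ _).trans_eq (Finset.sum_congr rfl fun u _ => ?_)
    rw [abs_mul, abs_of_nonneg (hP u v)]
  have hsum : ∑ v, |ψ v| = ∑ v, ∑ u, |ψ u| * P u v := by
    rw [Finset.sum_comm]
    simp [← Finset.mul_sum, hrow]
  have habs : ∀ v, |ψ v| = ∑ u, |ψ u| * P u v := fun v =>
    (Finset.sum_eq_sum_iff_of_le hle).mp hsum v (Finset.mem_univ v)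
  obtain ⟨u₀, hu₀⟩ : ∃ u, ψ u ≠ 0 := Function.ne_iff.mp hψ0
  have hpos : ∀ v, 0 < |ψ v| := by
    intro v
    induction hirr u₀ v with
    | refl => exact abs_pos.mpr hu₀
    | @tail c d _ hcd ih =>
      rw [habs d]
      exact (mul_pos ih hcd).trans_le (Finset.single_le_sum
        (f := fun u => |ψ u| * P u d) (fun u _ => mul_nonneg (abs_nonneg _) (hP u d))
        (Finset.mem_univ c))
  have htot : 0 < ∑ v, |ψ v| := Finset.sum_pos (fun v _ => hpos v) Finset.univ_nonempty
  refine ⟨fun v => |ψ v| / ∑ w, |ψ w|, fun v => div_pos (hpos v) htot, ?_, fun v => ?_⟩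
  · rw [← Finset.sum_div, div_self htot.ne']
  · beta_reduce
    rw [habs v, Finset.sum_div]
    exact Finset.sum_congr rfl fun u _ => by ring

end Harmonic

theorem WalkLen.trans {E : ℕ → ℕ → Bool} {k l u v w : ℕ} (h1 : WalkLen E k u v)
    (h2 : WalkLen E l v w) : ∃ m, WalkLen E m u w := by
  induction k generalizing u with
  | zero =>
    obtain rfl : u = v := h1
    exact ⟨l, h2⟩
  | succ k ih =>
    obtain ⟨c, hc, hw⟩ := h1
    obtain ⟨m, hm⟩ := ih hw
    exact ⟨m + 1, c, hc, hm⟩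

theorem WalkLen.reflTransGen {n : ℕ} {E : ℕ → ℕ → Bool} (hE : IsDigraph n E) {k : ℕ}
    {u v : Finset.Icc 1 n} (h : WalkLen E k u v) :
    Relation.ReflTransGen (fun u v : Finset.Icc 1 n => E u v = true) u v := by
  induction k generalizing u with
  | zero =>
    obtain rfl : u = v := Subtype.ext h
    exact .refl
  | succ k ih =>
    obtain ⟨c, hc, hw⟩ := h
    exact .head (b := ⟨c, (hE _ _ hc).2.1⟩) hc (ih hw)

theorem outDeg_pos {n : ℕ} {E : ℕ → ℕ → Bool} (hn : 2 ≤ n) (hE : IsDigraph n E)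
    (hS : StronglyConnected n E) {u : ℕ} (hu : u ∈ Finset.Icc 1 n) : 0 < outDeg n E u := by
  obtain ⟨v, hv, hvu⟩ : ∃ v ∈ Finset.Icc 1 n, v ≠ u := by
    by_cases h : u = 1
    · exact ⟨2, by simp; omega, by omega⟩
    · exact ⟨1, by simp; omega, by omega⟩
  obtain ⟨k, hk⟩ := hS u hu v hv
  cases k with
  | zero => exact absurd hk.symm hvu
  | succ k =>
    obtain ⟨c, hc, -⟩ := hk
    exact Finset.card_pos.mpr ⟨c, Finset.mem_filter.mpr ⟨(hE _ _ hc).2.1, hc⟩⟩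

theorem outDeg_eq_sum (n : ℕ) (E : ℕ → ℕ → Bool) (u : ℕ) :
    (outDeg n E u : ℝ) = ∑ v ∈ Finset.Icc 1 n, if E u v then 1 else 0 := by
  rw [Finset.sum_boole, outDeg]

theorem sum_ite_const (n : ℕ) (E : ℕ → ℕ → Bool) (u : ℕ) (c : ℝ) :
    ∑ v ∈ Finset.Icc 1 n, (if E u v then c else 0) = outDeg n E u * c := by
  rw [outDeg_eq_sum, Finset.sum_mul]
  exact Finset.sum_congr rfl fun v _ => by split_ifs <;> simp

theorem exists_perron {n : ℕ} {E : ℕ → ℕ → Bool} (hn : 2 ≤ n) (hE : IsDigraph n E)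
    (hS : StronglyConnected n E) : ∃ φ, IsPerron n E φ := by
  have : Nonempty (Finset.Icc 1 n) := ⟨⟨1, by simp; omega⟩⟩
  have hd : ∀ u ∈ Finset.Icc 1 n, (0 : ℝ) < outDeg n E u := fun u hu =>
    Nat.cast_pos.mpr (outDeg_pos hn hE hS hu)
  obtain ⟨ψ, hpos, hsum, hstat⟩ := exists_stationary (V := Finset.Icc 1 n)
    (P := fun u v => if E u v then 1 / (outDeg n E u : ℝ) else 0)
    (fun u v => by
      split_ifs
      · positivity
      · exact le_rfl)
    (fun u => by
      rw [Finset.sum_coe_sort (Finset.Icc 1 n)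
        (fun v => if E u v then 1 / (outDeg n E u : ℝ) else 0), sum_ite_const,
        mul_one_div_cancel (hd u u.2).ne'])
    (fun u v => by
      obtain ⟨k, hk⟩ := hS u u.2 v v.2
      refine Relation.ReflTransGen.mono (fun c d hcd => ?_) _ _ (hk.reflTransGen hE)
      rw [if_pos hcd]
      exact one_div_pos.mpr (hd c c.2))
  refine ⟨fun u => if hu : u ∈ Finset.Icc 1 n then ψ ⟨u, hu⟩ else 0, fun v hv => ?_, ?_,
    fun v hv => ?_⟩
  · simp only [dif_pos hv]
    exact hpos _
  · rw [← hsum, ← Finset.sum_coe_sort]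
    exact Finset.sum_congr rfl fun v _ => by rw [dif_pos v.2]
  · simp only [dif_pos hv]
    rw [hstat, ← Finset.sum_coe_sort (Finset.Icc 1 n)]
    refine Finset.sum_congr rfl fun u _ => ?_
    rw [dif_pos u.2]
    split_ifs <;> simp [div_eq_mul_inv]

theorem exists_potential {n : ℕ} {E : ℕ → ℕ → Bool} (hE : IsDigraph n E)
    (hS : StronglyConnected n E) {a b : ℕ} (ha : a ∈ Finset.Icc 1 n) (hb : b ∈ Finset.Icc 1 n)
    (hab : a ≠ b) :
    ∃ h : ℕ → ℝ, h a = 0 ∧ h b = 1 ∧ (∀ u ∈ Finset.Icc 1 n, 0 ≤ h u ∧ h u ≤ 1) ∧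
      ∀ u ∈ Finset.Icc 1 n, u ≠ a → u ≠ b →
        ∑ v ∈ Finset.Icc 1 n, (if E u v then h v - h u else 0) = 0 := by
  obtain ⟨g, hga, hgb, hg01, hharm⟩ := exists_harmonic (V := Finset.Icc 1 n)
    (A := fun u v => E u v) (a := ⟨a, ha⟩) (b := ⟨b, hb⟩) (by simpa using hab)
    (fun u => by
      obtain ⟨k, hk⟩ := hS u u.2 a ha
      exact WalkLen.reflTransGen (v := ⟨a, ha⟩) hE hk)
  refine ⟨fun u => if hu : u ∈ Finset.Icc 1 n then g ⟨u, hu⟩ else 0, ?_, ?_, fun u hu => ?_,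
    fun u hu hua hub => ?_⟩
  · simp only [dif_pos ha, hga]
  · simp only [dif_pos hb, hgb]
  · simp only [dif_pos hu]
    exact hg01 _
  · rw [← Finset.sum_coe_sort]
    refine Eq.trans (Finset.sum_congr rfl fun v _ => ?_)
      (hharm ⟨u, hu⟩ (by simpa using hua) (by simpa using hub))
    simp only [dif_pos v.2, dif_pos hu]

/-- The random walk started from the Perron vector has no drift. -/
theorem IsPerron.sum_drift {n : ℕ} {E : ℕ → ℕ → Bool} {φ : ℕ → ℝ} (hφ : IsPerron n E φ)
    (hd : ∀ u ∈ Finset.Icc 1 n, 0 < outDeg n E u) (f : ℕ → ℝ) :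
    ∑ u ∈ Finset.Icc 1 n, φ u / outDeg n E u *
      ∑ v ∈ Finset.Icc 1 n, (if E u v then f v - f u else 0) = 0 := by
  have h1 : ∀ u ∈ Finset.Icc 1 n, φ u / outDeg n E u *
      ∑ v ∈ Finset.Icc 1 n, (if E u v then f v - f u else 0) =
      ∑ v ∈ Finset.Icc 1 n, (if E u v then φ u / outDeg n E u else 0) * f v - φ u * f u := by
    intro u hu
    have hne : (outDeg n E u : ℝ) ≠ 0 := (Nat.cast_pos.mpr (hd u hu)).ne'
    have hsplit : ∑ v ∈ Finset.Icc 1 n, (if E u v then f v - f u else 0) =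
        ∑ v ∈ Finset.Icc 1 n, (if E u v then f v else 0) - outDeg n E u * f u := by
      rw [← sum_ite_const, ← Finset.sum_sub_distrib]
      exact Finset.sum_congr rfl fun v _ => by split_ifs <;> simp
    rw [hsplit, mul_sub, Finset.mul_sum]
    congr 1
    · exact Finset.sum_congr rfl fun v _ => by split_ifs <;> simp
    · field_simp
  rw [Finset.sum_congr rfl h1, Finset.sum_sub_distrib, Finset.sum_comm, sub_eq_zero]
  refine Finset.sum_congr rfl fun v hv => ?_
  rw [← Finset.sum_mul, ← hφ.2.2 v hv]

theorem exists_sorted_enumeration {n : ℕ} {a b : ℕ} (ha : a ∈ Finset.Icc 1 n)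
    (hb : b ∈ Finset.Icc 1 n) (hab : a ≠ b) {h : ℕ → ℝ} (h0 : h a = 0) (h1 : h b = 1)
    (h01 : ∀ u ∈ Finset.Icc 1 n, 0 ≤ h u ∧ h u ≤ 1) :
    ∃ w : ℕ → ℕ, Set.BijOn w (Finset.range n) (Finset.Icc 1 n) ∧ w 0 = a ∧ w (n - 1) = b ∧
      ∀ i j, i ≤ j → j < n → h (w i) ≤ h (w j) := by
  let κ : ℕ → ℝ := fun u => if u = a then -1 else if u = b then 2 else h u
  have hκa : κ a = -1 := if_pos rfl
  have hκb : κ b = 2 := by simp [κ, hab.symm]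
  have hκ : ∀ u, u ≠ a → u ≠ b → κ u = h u := fun u h1 h2 => by simp [κ, h1, h2]
  let e : Equiv.Perm (Fin n) := Tuple.sort fun i : Fin n => κ (i + 1)
  have he : Monotone fun i => κ (e i + 1) := Tuple.monotone_sort fun i : Fin n => κ (i + 1)
  let w : ℕ → ℕ := fun i => if hi : i < n then e ⟨i, hi⟩ + 1 else 0
  have hw : ∀ i (hi : i < n), w i = e ⟨i, hi⟩ + 1 := fun i hi => dif_pos hi
  have hmono : ∀ i j, i ≤ j → j < n → κ (w i) ≤ κ (w j) := by
    intro i j hij hj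
    rw [hw i (by omega), hw j hj]
    exact he (by simpa using hij)
  have hmaps : ∀ i < n, w i ∈ Finset.Icc 1 n := by
    intro i hi
    have := (e ⟨i, hi⟩).2
    rw [hw i hi, Finset.mem_Icc]
    omega
  have hsurj : ∀ u ∈ Finset.Icc 1 n, ∃ i < n, w i = u := by
    intro u hu
    rw [Finset.mem_Icc] at hu
    refine ⟨e.symm ⟨u - 1, by omega⟩, (e.symm ⟨u - 1, by omega⟩).2, ?_⟩
    rw [hw _ (e.symm ⟨u - 1, by omega⟩).2, Fin.eta, Equiv.apply_symm_apply]
    simp only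
    omega
  have hinj : ∀ i < n, ∀ j < n, w i = w j → i = j := by
    intro i hi j hj hij
    rw [hw i hi, hw j hj] at hij
    have : e ⟨i, hi⟩ = e ⟨j, hj⟩ := Fin.ext (by omega)
    simpa using e.injective this
  obtain ⟨i, hi, hia⟩ := hsurj a ha
  obtain ⟨j, hj, hjb⟩ := hsurj b hb
  have hw0 : w 0 = a := by
    by_contra hne
    have hle := hmono 0 i (Nat.zero_le _) hi
    rw [hia, hκa] at hle
    by_cases hb0 : w 0 = b
    · rw [hb0, hκb] at hle
      norm_num at hle
    · rw [hκ _ hne hb0] at hle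
      linarith [(h01 (w 0) (hmaps 0 (by omega))).1]
  have hwN : w (n - 1) = b := by
    by_contra hne
    have hle := hmono j (n - 1) (by omega) (by omega)
    rw [hjb, hκb] at hle
    by_cases ha0 : w (n - 1) = a
    · rw [ha0, hκa] at hle
      norm_num at hle
    · rw [hκ _ ha0 hne] at hle
      linarith [(h01 (w (n - 1)) (hmaps _ (by omega))).2]
  refine ⟨w, ⟨fun i hi => hmaps i (by simpa using hi),
    fun i hi j hj => hinj i (by simpa using hi) j (by simpa using hj), fun u hu => ?_⟩,
    hw0, hwN, fun i j hij hj => ?_⟩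
  · obtain ⟨i, hi, rfl⟩ := hsurj u hu
    exact ⟨i, by simpa using hi, rfl⟩
  · have hle := hmono i j hij hj
    by_cases hia : w i = a
    · rw [hia, h0]
      exact (h01 _ (hmaps j hj)).1
    by_cases hjb : w j = b
    · rw [hjb, h1]
      exact (h01 _ (hmaps i (by omega))).2
    have hja : w j ≠ a := fun h => hia (by
      have := hinj j hj 0 (by omega) (h.trans hw0.symm)
      rw [show i = 0 by omega, hw0])
    have hib : w i ≠ b := fun h => hjb (by
      have := hinj i (by omega) (n - 1) (by omega) (h.trans hwN.symm)
      rw [show j = n - 1 by omega, hwN])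
    rwa [hκ _ hia hib, hκ _ hja hjb] at hle

theorem WalkLen.exists_cross {E : ℕ → ℕ → Bool} {p : ℕ → Prop} {k u v : ℕ}
    (h : WalkLen E k u v) (hu : p u) (hv : ¬ p v) : ∃ c d, p c ∧ ¬ p d ∧ E c d = true := by
  induction k generalizing u with
  | zero => exact absurd (h ▸ hu) hv
  | succ k ih =>
    obtain ⟨c, hc, hw⟩ := h
    by_cases hpc : p c
    · exact ih hw hpc
    · exact ⟨u, c, hu, hpc, hc⟩

theorem sum_enumeration {n : ℕ} {w : ℕ → ℕ}
    (hw : Set.BijOn w (Finset.range n) (Finset.Icc 1 n)) (f : ℕ → ℝ) :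
    ∑ i ∈ Finset.range n, f (w i) = ∑ u ∈ Finset.Icc 1 n, f u :=
  Finset.sum_nbij w (fun _ hi => hw.mapsTo hi) hw.injOn hw.surjOn fun _ _ => rfl

/-- Sorting the vertices by a potential yields a profile. -/
theorem profile_of_enumeration {n : ℕ} {E : ℕ → ℕ → Bool} (hn : 2 ≤ n) (hE : IsDigraph n E)
    (hS : StronglyConnected n E) {a b : ℕ} {h : ℕ → ℝ} (h0 : h a = 0)
    (hharm : ∀ u ∈ Finset.Icc 1 n, u ≠ a → u ≠ b →
        ∑ v ∈ Finset.Icc 1 n, (if E u v then h v - h u else 0) = 0)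
    {w : ℕ → ℕ} (hw : Set.BijOn w (Finset.range n) (Finset.Icc 1 n)) (hw0 : w 0 = a)
    (hwN : w (n - 1) = b) (hmono : ∀ i j, i ≤ j → j < n → h (w i) ≤ h (w j)) :
    Profile (n - 1) (fun i j => E (w i) (w j)) (fun i => h (w i))
      ((∑ v ∈ Finset.Icc 1 n, if E a v then h v else 0) / outDeg n E a) := by
  have hmem : ∀ i < n, w i ∈ Finset.Icc 1 n := fun i hi => hw.mapsTo (by simpa using hi)
  have hinj : ∀ i < n, ∀ j < n, w i = w j → i = j := fun i hi j hj hij =>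
    hw.injOn (by simpa using hi) (by simpa using hj) hij
  have ha : a ∈ Finset.Icc 1 n := hw0 ▸ hmem 0 (by omega)
  have hb : b ∈ Finset.Icc 1 n := hwN ▸ hmem (n - 1) (by omega)
  have hn1 : n - 1 + 1 = n := by omega
  refine ⟨fun i j hij hj => hmono i j hij (by omega), by simp only [hw0, h0], fun i => ?_,
    fun i hi hiN => ?_, ?_, fun j hj hjN => ?_⟩
  · by_contra hc
    exact (hE _ _ (by simpa using hc)).2.2 rfl
  · rw [hn1, sum_enumeration hw (fun u => if E (w i) u then h (w i) - h u else 0)]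
    have hia : w i ≠ a := fun hc => by
      have := hinj i (by omega) 0 (by omega) (hc.trans hw0.symm)
      omega
    have hib : w i ≠ b := fun hc => by
      have := hinj i (by omega) (n - 1) (by omega) (hc.trans hwN.symm)
      omega
    rw [← neg_eq_zero, ← Finset.sum_neg_distrib]
    refine Eq.trans (Finset.sum_congr rfl fun v _ => ?_) (hharm _ (hmem i (by omega)) hia hib)
    split_ifs <;> ring
  · rw [hn1, sum_enumeration hw (fun u => if E (w 0) u then _ - h u else 0), hw0]
    have hd : (outDeg n E a : ℝ) ≠ 0 := (Nat.cast_pos.mpr (outDeg_pos hn hE hS ha)).ne'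
    set p := (∑ v ∈ Finset.Icc 1 n, if E a v then h v else 0) / (outDeg n E a : ℝ) with hp
    have : ∑ v ∈ Finset.Icc 1 n, (if E a v then p - h v else 0) =
        outDeg n E a * p - ∑ v ∈ Finset.Icc 1 n, (if E a v then h v else 0) := by
      rw [← sum_ite_const, ← Finset.sum_sub_distrib]
      exact Finset.sum_congr rfl fun v _ => by split_ifs <;> simp
    rw [this, hp, mul_div_cancel₀ _ hd, sub_self]
  · obtain ⟨k, hk⟩ := hS a ha b hb
    obtain ⟨c, d, ⟨i, hi, rfl⟩, hd, hcd⟩ := hk.exists_cross (p := fun u => ∃ i < j, w i = u)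
      ⟨0, hj, hw0⟩ (by
        rintro ⟨i, hi, hib⟩
        have := hinj i (by omega) (n - 1) (by omega) (hib.trans hwN.symm)
        omega)
    obtain ⟨l, hl, rfl⟩ := hw.surjOn (hE _ _ hcd).2.1
    simp only [Finset.coe_range, Set.mem_Iio] at hl
    refine ⟨i, hi, l, ?_, by omega, hcd⟩
    by_contra hlj
    exact hd ⟨l, by omega, rfl⟩

theorem isoTo_of_bijOn {n : ℕ} {E E' : ℕ → ℕ → Bool} {τ : ℕ → ℕ}
    (hτ : Set.BijOn τ (Finset.Icc 1 n) (Finset.Icc 1 n))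
    (h : ∀ u ∈ Finset.Icc 1 n, ∀ v ∈ Finset.Icc 1 n, (E' u v = true ↔ E (τ u) (τ v) = true)) :
    IsoTo n E E' := by
  have hinv := hτ.invOn_invFunOn
  have hbij := Set.BijOn.symm hinv.symm hτ
  refine ⟨Function.invFunOn τ (Finset.Icc 1 n), hbij, fun u hu v hv => ?_⟩
  rw [h _ (hbij.mapsTo hu) _ (hbij.mapsTo hv), hinv.2 hu, hinv.2 hv]

/-- `E'` has the path edges `(v_i,v_{i+1})`, all back edges among the first `n - 1` vertices, and
edges from `v_n` to the vertices satisfying `S`. -/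
def IsBackPath (n : ℕ) (S : ℕ → Prop) (E' : ℕ → ℕ → Bool) : Prop :=
  ∀ u ∈ Finset.Icc 1 n, ∀ v ∈ Finset.Icc 1 n,
    (E' u v = true ↔ u < n ∧ (v = u + 1 ∨ v < u) ∨ u = n ∧ S v)

theorem isBackPath_E1 (n : ℕ) : IsBackPath n (fun v => v = 1) (E1 n) := by
  intro u hu v hv
  simp only [Finset.mem_Icc] at hu hv
  simp only [E1, decide_eq_true_eq]
  omega

theorem isBackPath_E2 (n : ℕ) : IsBackPath n (fun v => v = 2) (E2 n) := by
  intro u hu v hv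
  simp only [Finset.mem_Icc] at hu hv
  simp only [E2, decide_eq_true_eq]
  omega

theorem isBackPath_E3 (n : ℕ) : IsBackPath n (fun v => v = 1 ∨ v = 2) (E3 n) := by
  intro u hu v hv
  simp only [Finset.mem_Icc] at hu hv
  simp only [E3, decide_eq_true_eq]
  omega

/-- Position of `v_j` in the order by potential of the extremal graphs. -/
def position (j : ℕ) : ℕ := if j = 2 then 0 else if j = 1 then 1 else j - 1

theorem bijOn_position {n : ℕ} (hn : 2 ≤ n) :
    Set.BijOn position (Finset.Icc 1 n) (Finset.range n) := by
  refine ⟨fun j hj => ?_, fun i hi j hj hij => ?_, fun i hi => ?_⟩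
  · simp only [Finset.coe_Icc, Set.mem_Icc] at hj
    simp only [Finset.coe_range, Set.mem_Iio, position]
    split_ifs <;> omega
  · simp only [Finset.coe_Icc, Set.mem_Icc] at hi hj
    simp only [position] at hij
    split_ifs at hij <;> omega
  · simp only [Finset.coe_range, Set.mem_Iio] at hi
    refine ⟨if i = 0 then 2 else if i = 1 then 1 else i + 1, ?_, ?_⟩
    · simp only [Finset.coe_Icc, Set.mem_Icc]
      split_ifs <;> omega
    · simp only [position]
      split_ifs <;> omega

theorem isoTo_of_edges {n : ℕ} {E E' : ℕ → ℕ → Bool} (hn : 3 ≤ n) {w : ℕ → ℕ}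
    (hw : Set.BijOn w (Finset.range n) (Finset.Icc 1 n))
    (h0 : ∀ v ≤ n - 1, (E (w 0) (w v) = true ↔ v = 1 ∨ v = 2))
    (h1 : ∀ v ≤ n - 1, (E (w 1) (w v) = true ↔ v = 0))
    (h2 : ∀ i, 2 ≤ i → i < n - 1 → ∀ v ≤ n - 1, (E (w i) (w v) = true ↔ v < i ∨ v = i + 1))
    {S : ℕ → Prop}
    (hS : ∀ v ∈ Finset.Icc 1 n, (E (w (n - 1)) (w (position v)) = true ↔ S v))
    (hE' : IsBackPath n S E') : IsoTo n E E' := by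
  have hpos := bijOn_position (n := n) (by omega)
  refine isoTo_of_bijOn (hw.comp hpos) fun u hu v hv => ?_
  rw [hE' u hu v hv, Function.comp_apply, Function.comp_apply]
  have hvN : position v ≤ n - 1 := by
    have := hpos.mapsTo hv
    simp only [Finset.coe_range, Set.mem_Iio] at this
    omega
  have hSv := hS v hv
  simp only [Finset.mem_Icc] at hu hv
  rcases hu.2.lt_or_eq with hun | rfl
  · have hne : u ≠ n := hun.ne
    simp only [hun, hne, true_and, false_and, or_false]
    obtain rfl | rfl | hu3 : u = 1 ∨ u = 2 ∨ 3 ≤ u := by omega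
    · rw [show position 1 = 1 from rfl, h1 _ hvN]
      unfold position
      grind
    · rw [show position 2 = 0 from rfl, h0 _ hvN]
      unfold position
      grind
    · have hpu : position u = u - 1 := by
        simp only [position]
        split_ifs <;> omega
      rw [hpu, h2 _ (by omega) (by omega) _ hvN]
      simp only [position]
      split_ifs <;> omega
  · have hpu : position u = u - 1 := by
      simp only [position]
      split_ifs <;> omega
    rw [hpu, hSv]
    simp

/-- The maximal principal ratio for `n` vertices. -/
noncomputable def maxRatio (n : ℕ) : ℝ := 2 / 3 * factSum (n - 1)

theorem two_le_maxRatio {n : ℕ} (hn : 3 ≤ n) : 2 ≤ maxRatio n := by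
  have := factSum_strictMono.monotone (show 2 ≤ n - 1 by omega)
  rw [factSum_two] at this
  unfold maxRatio
  linarith

/-- The extremal structure determines the digraph up to isomorphism. -/
theorem isoTo_of_profile {n : ℕ} {E : ℕ → ℕ → Bool} (hn : 3 ≤ n) (hE : IsDigraph n E)
    (hS : StronglyConnected n E) {h : ℕ → ℝ} {p : ℝ} {w : ℕ → ℕ}
    (hw : Set.BijOn w (Finset.range n) (Finset.Icc 1 n))
    (H : Profile (n - 1) (fun i j => E (w i) (w j)) (fun i => h (w i)) p) (hp : 0 < p)
    (htop : h (w (n - 1)) = maxRatio n * p)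
    (hsink : ∀ v ≤ n - 1, E (w (n - 1)) (w v) = true → h (w v) = 0) :
    IsoTo n E (E1 n) ∨ IsoTo n E (E2 n) ∨ IsoTo n E (E3 n) := by
  have hout : ∀ i ≤ n - 1, ∃ v ≤ n - 1, E (w i) (w v) = true := by
    intro i hi
    obtain ⟨v, hv⟩ := Finset.card_pos.mp
      (outDeg_pos (by omega) hE hS (hw.mapsTo (show i ∈ _ by simp; omega)))
    rw [Finset.mem_filter] at hv
    obtain ⟨j, hj, rfl⟩ := hw.surjOn hv.1
    exact ⟨j, by simp at hj; omega, hv.2⟩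
  obtain ⟨k, hk1, hkN, hk, hlow⟩ := H.exists_first (by omega)
  rcases H.first_of_top_eq (by omega) hp hk1 hkN hk hlow htop with rfl | ⟨rfl, hN⟩
  · obtain ⟨hx1, hpos, h0, h1, h2⟩ := H.edges_of_first_two (by omega) hp
      (hlow 1 le_rfl one_lt_two) hk htop (hout 1 (by omega))
    have hsink' : ∀ v ≤ n - 1, E (w (n - 1)) (w v) = true → v = 0 ∨ v = 1 := by
      intro v hv hv'
      by_contra! hne
      exact (hpos v (by omega) hv).ne' (hsink v hv hv')
    have hposn : ∀ v ∈ Finset.Icc 1 n, position v ≤ n - 1 := fun v hv => by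
      rw [Finset.mem_Icc] at hv
      simp only [position]
      split_ifs <;> omega
    have hpos_zero : ∀ v ∈ Finset.Icc 1 n, (position v = 0 ↔ v = 2) := fun v hv => by
      rw [Finset.mem_Icc] at hv
      unfold position
      grind
    have hpos_one : ∀ v ∈ Finset.Icc 1 n, (position v = 1 ↔ v = 1) := fun v hv => by
      rw [Finset.mem_Icc] at hv
      unfold position
      grind
    by_cases e0 : E (w (n - 1)) (w 0) = true <;> by_cases e1 : E (w (n - 1)) (w 1) = true
    · refine Or.inr (Or.inr (isoTo_of_edges hn hw h0 h1 h2 (fun v hv => ?_) (isBackPath_E3 n)))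
      rw [← hpos_zero v hv, ← hpos_one v hv]
      refine ⟨fun h' => (hsink' _ (hposn v hv) h').symm, ?_⟩
      rintro (h' | h') <;> rwa [h']
    · refine Or.inr (Or.inl (isoTo_of_edges hn hw h0 h1 h2 (fun v hv => ?_) (isBackPath_E2 n)))
      rw [← hpos_zero v hv]
      refine ⟨fun h' => (hsink' _ (hposn v hv) h').resolve_right fun h'' => ?_, fun h' => ?_⟩
      · rw [h''] at h'
        exact e1 h'
      · rwa [h']
    · refine Or.inl (isoTo_of_edges hn hw h0 h1 h2 (fun v hv => ?_) (isBackPath_E1 n))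
      rw [← hpos_one v hv]
      refine ⟨fun h' => (hsink' _ (hposn v hv) h').resolve_left fun h'' => ?_, fun h' => ?_⟩
      · rw [h''] at h'
        exact e0 h'
      · rwa [h']
    · obtain ⟨v, hv, hv'⟩ := hout (n - 1) le_rfl
      rcases hsink' v hv hv' with rfl | rfl
      · exact absurd hv' e0
      · exact absurd hv' e1
  · obtain rfl : n = 3 := by omega
    obtain ⟨h0, h1⟩ := H.edges_of_first_one hp hk htop
    have hx1 : 0 < h (w 1) := hp.trans_le hk
    have hx2 : 0 < h (w 2) := hx1.trans_le (H.mono 1 2 one_le_two le_rfl)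
    have h2 : ∀ v ≤ 2, (E (w 2) (w v) = true ↔ v = 0) := by
      have hsub : ∀ v ≤ 2, E (w 2) (w v) = true → v = 0 := by
        intro v hv hv'
        have hz := hsink v hv hv'
        by_contra hne
        obtain rfl | rfl : v = 1 ∨ v = 2 := by omega
        · exact hx1.ne' hz
        · exact hx2.ne' hz
      refine fun v hv => ⟨hsub v hv, ?_⟩
      rintro rfl
      obtain ⟨u, hu, hu'⟩ := hout 2 le_rfl
      exact hsub u hu hu' ▸ hu'
    have hpred : Set.BijOn (fun j => j - 1) (Finset.Icc 1 3) (Finset.range 3) := by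
      refine ⟨fun j hj => ?_, fun i hi j hj hij => ?_, fun i hi => ⟨i + 1, ?_, rfl⟩⟩
      · simp at hj ⊢; omega
      · simp at hi hj hij; omega
      · simp at hi ⊢; omega
    refine Or.inl (isoTo_of_bijOn (hw.comp hpred) fun u hu v hv => ?_)
    rw [isBackPath_E1 3 u hu v hv, Function.comp_apply, Function.comp_apply]
    simp only [Finset.mem_Icc] at hu hv
    obtain rfl | rfl | rfl : u = 1 ∨ u = 2 ∨ u = 3 := by omega
    · rw [h0 _ (by omega)]
      omega
    · rw [h1 _ (by omega)]
      omega
    · rw [h2 _ (by omega)]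
      omega

/-- Ratio bound for two distinct vertices, with the equality case. -/
theorem IsPerron.le_maxRatio_mul {n : ℕ} {E : ℕ → ℕ → Bool} {φ : ℕ → ℝ} (hn : 3 ≤ n)
    (hE : IsDigraph n E) (hS : StronglyConnected n E) (hφ : IsPerron n E φ) {a b : ℕ}
    (ha : a ∈ Finset.Icc 1 n) (hb : b ∈ Finset.Icc 1 n) (hab : a ≠ b) :
    φ a ≤ maxRatio n * φ b ∧ (φ a = maxRatio n * φ b →
      IsoTo n E (E1 n) ∨ IsoTo n E (E2 n) ∨ IsoTo n E (E3 n)) := by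
  obtain ⟨h, h0, h1, h01, hharm⟩ := exists_potential hE hS ha hb hab
  obtain ⟨w, hw, hw0, hwN, hmono⟩ := exists_sorted_enumeration ha hb hab h0 h1 h01
  have hdeg : ∀ u ∈ Finset.Icc 1 n, 0 < outDeg n E u := fun u hu =>
    outDeg_pos (by omega) hE hS hu
  have H := profile_of_enumeration (by omega) hE hS h0 hharm hw hw0 hwN hmono
  set p := (∑ v ∈ Finset.Icc 1 n, if E a v then h v else 0) / (outDeg n E a : ℝ) with hp
  set q := ∑ v ∈ Finset.Icc 1 n, (if E b v then h v else 0) with hq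
  have hterm : ∀ v ∈ Finset.Icc 1 n, 0 ≤ if E b v then h v else 0 := by
    intro v hv
    split_ifs
    · exact (h01 v hv).1
    · exact le_rfl
  have hq0 : 0 ≤ q := Finset.sum_nonneg hterm
  have hda : (0 : ℝ) < outDeg n E a := Nat.cast_pos.mpr (hdeg a ha)
  have hdb : (0 : ℝ) < outDeg n E b := Nat.cast_pos.mpr (hdeg b hb)
  have hφa := hφ.1 a ha
  have hφb := hφ.1 b hb
  have hident : φ a * p = φ b - φ b / outDeg n E b * q := by
    have hdrift := hφ.sum_drift hdeg h
    rw [Finset.sum_eq_add_of_mem a b ha hb hab (fun c hc hne => by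
      rw [hharm c hc hne.1 hne.2, mul_zero])] at hdrift
    have hsb : ∑ v ∈ Finset.Icc 1 n, (if E b v then h v - h b else 0) = q - outDeg n E b := by
      rw [hq, ← mul_one (outDeg n E b : ℝ), ← sum_ite_const, ← Finset.sum_sub_distrib, h1]
      exact Finset.sum_congr rfl fun v _ => by split_ifs <;> simp
    have hsa : ∑ v ∈ Finset.Icc 1 n, (if E a v then h v - h a else 0) = outDeg n E a * p := by
      rw [hp, mul_div_cancel₀ _ hda.ne']
      simp [h0]
    rw [hsa, hsb] at hdrift
    field_simp at hdrift ⊢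
    linarith
  have htop : 1 ≤ maxRatio n * p := by
    have := H.top_le (by omega)
    simp only [hwN, h1] at this
    exact this
  have hγ : 0 < maxRatio n := lt_of_lt_of_le two_pos (two_le_maxRatio hn)
  have hp0 : 0 < p := by
    by_contra! hle
    nlinarith
  have hcorr : 0 ≤ φ b / outDeg n E b * q := by positivity
  have hmain : φ a * (maxRatio n * p) = maxRatio n * φ b - maxRatio n * (φ b / outDeg n E b * q) := by
    rw [← mul_sub, ← hident]
    ring
  have hcorr' := mul_nonneg hγ.le hcorr
  have hlow := mul_le_mul_of_nonneg_left htop hφa.le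
  refine ⟨by linarith, fun heq => ?_⟩
  have htop' : maxRatio n * p = 1 := by
    refine le_antisymm ?_ htop
    by_contra! hlt
    have := mul_lt_mul_of_pos_left hlt hφa
    linarith
  have hqz : q = 0 := by
    rw [htop'] at hmain
    have : maxRatio n * (φ b / outDeg n E b * q) = 0 := by linarith
    have hne : φ b / (outDeg n E b : ℝ) ≠ 0 := (div_pos hφb hdb).ne'
    simpa [hγ.ne', hne] using this
  refine isoTo_of_profile hn hE hS hw H hp0 (by rw [hwN, h1, htop']) fun v hv hbv => ?_
  rw [hwN] at hbv
  have := (Finset.sum_eq_zero_iff_of_nonneg hterm).mp hqz (w v) (hE _ _ hbv).2.1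
  rwa [if_pos hbv] at this

/-- Potential of the extremal graphs, up to scaling. -/
noncomputable def backPathPotential (v : ℕ) : ℝ := if v ≤ 2 then 0 else factSum (v - 1)

theorem backPathPotential_succ {s : ℕ} (hs : 3 ≤ s) :
    backPathPotential (s + 1) = backPathPotential s + (Nat.factorial s : ℝ) := by
  obtain ⟨t, rfl⟩ : ∃ t, s = t + 1 := ⟨s - 1, by omega⟩
  rw [backPathPotential, backPathPotential, if_neg (by omega), if_neg (by omega),
    Nat.add_sub_cancel, Nat.add_sub_cancel, factSum_succ]

theorem sum_gap_backPathPotential {s : ℕ} (hs : 3 ≤ s) :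
    ∑ v ∈ Finset.Ico 1 s, (backPathPotential v - backPathPotential s) =
      -(Nat.factorial s : ℝ) := by
  induction s, hs using Nat.le_induction with
  | base =>
    norm_num [Finset.sum_Ico_succ_top, backPathPotential, factSum_two, Nat.factorial]
  | succ s hs ih =>
    rw [Finset.sum_Ico_succ_top (by omega), backPathPotential_succ hs, Nat.factorial_succ]
    simp only [Finset.sum_sub_distrib, Finset.sum_const, Nat.card_Ico, nsmul_eq_mul,
      Nat.cast_sub (show 1 ≤ s by omega)] at ih ⊢
    push_cast at ih ⊢
    linarith

theorem backPathPotential_drift {s : ℕ} (hs : 1 ≤ s) :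
    (backPathPotential (s + 1) - backPathPotential s) +
      ∑ v ∈ Finset.Ico 1 s, (backPathPotential v - backPathPotential s) =
      if s = 2 then 3 else 0 := by
  obtain rfl | rfl | h3 : s = 1 ∨ s = 2 ∨ 3 ≤ s := by omega
  · simp [backPathPotential]
  · simp [backPathPotential, factSum_two]
  · rw [sum_gap_backPathPotential h3, backPathPotential_succ h3, if_neg (by omega)]
    ring

theorem IsBackPath.sum_out {n : ℕ} {S : ℕ → Prop} {E' : ℕ → ℕ → Bool} (hE' : IsBackPath n S E')
    {s : ℕ} (hs : 1 ≤ s) (hsn : s < n) (g : ℕ → ℝ) :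
    ∑ v ∈ Finset.Icc 1 n, (if E' s v then g v else 0) =
      g (s + 1) + ∑ v ∈ Finset.Ico 1 s, g v := by
  rw [← Finset.sum_filter, ← Finset.sum_insert (by simp)]
  congr 1
  ext v
  simp only [Finset.mem_filter, Finset.mem_insert, Finset.mem_Ico]
  constructor
  · rintro ⟨hv, hA⟩
    rw [hE' s (by simp; omega) v hv] at hA
    simp only [Finset.mem_Icc] at hv
    omega
  · intro h
    have hv : v ∈ Finset.Icc 1 n := by simp only [Finset.mem_Icc]; omega
    refine ⟨hv, ?_⟩
    rw [hE' s (by simp; omega) v hv]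
    omega

/-- The extremal graphs attain the maximal ratio. -/
theorem IsPerron.exists_ratio_eq {n : ℕ} {E E' : ℕ → ℕ → Bool} {φ : ℕ → ℝ} {S : ℕ → Prop}
    (hn : 3 ≤ n) (hE : IsDigraph n E) (hSC : StronglyConnected n E) (hφ : IsPerron n E φ)
    (hiso : IsoTo n E E') (hE' : IsBackPath n S E') (hS : ∀ v, S v → v ≤ 2) :
    ∃ a ∈ Finset.Icc 1 n, ∃ b ∈ Finset.Icc 1 n, φ a = maxRatio n * φ b := by
  obtain ⟨σ, hσ, hadj⟩ := hiso
  have hdeg : ∀ u ∈ Finset.Icc 1 n, 0 < outDeg n E u := fun u hu =>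
    outDeg_pos (by omega) hE hSC hu
  have htransfer : ∀ u ∈ Finset.Icc 1 n, ∀ g : ℕ → ℝ,
      ∑ v ∈ Finset.Icc 1 n, (if E u v then g (σ v) else 0) =
        ∑ v ∈ Finset.Icc 1 n, if E' (σ u) v then g v else 0 := by
    intro u hu g
    refine Finset.sum_nbij σ (fun v hv => hσ.mapsTo hv) hσ.injOn hσ.surjOn fun v hv => ?_
    simp only [hadj u hu v hv]
  obtain ⟨a, ha, ha2⟩ := hσ.surjOn (show 2 ∈ _ by simp; omega)
  obtain ⟨b, hb, hbn⟩ := hσ.surjOn (show n ∈ _ by simp; omega)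
  have hab : a ≠ b := by
    rintro rfl
    omega
  have hdrift := hφ.sum_drift hdeg (fun v => backPathPotential (σ v))
  have hinner : ∀ u ∈ Finset.Icc 1 n, σ u < n →
      ∑ v ∈ Finset.Icc 1 n,
        (if E u v then backPathPotential (σ v) - backPathPotential (σ u) else 0) =
        if σ u = 2 then 3 else 0 := by
    intro u hu hun
    have h1 : 1 ≤ σ u := (Finset.mem_Icc.mp (hσ.mapsTo hu)).1
    rw [htransfer u hu (fun v => backPathPotential v - backPathPotential (σ u)),
      hE'.sum_out h1 hun, backPathPotential_drift h1]
  rw [Finset.sum_eq_add_of_mem a b ha hb hab (fun c hc hne => by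
    have hcn : σ c ≠ n := fun h => hne.2 (hσ.injOn hc hb (h.trans hbn.symm))
    have hc2 : σ c ≠ 2 := fun h => hne.1 (hσ.injOn hc ha (h.trans ha2.symm))
    have := (Finset.mem_Icc.mp (hσ.mapsTo hc)).2
    rw [hinner c hc (by omega), if_neg hc2, mul_zero]), hinner a ha (by omega), if_pos ha2]
    at hdrift
  have hdega : (outDeg n E a : ℝ) = 2 := by
    rw [outDeg_eq_sum, htransfer a ha (fun _ => 1), ha2, hE'.sum_out (by omega) (by omega)]
    norm_num
  have hsb : ∑ v ∈ Finset.Icc 1 n,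
      (if E b v then backPathPotential (σ v) - backPathPotential (σ b) else 0) =
      outDeg n E b * -factSum (n - 1) := by
    rw [← sum_ite_const]
    refine Finset.sum_congr rfl fun v hv => ?_
    split_ifs with hbv
    · have hA := (hadj b hb v hv).mp hbv
      rw [hE' _ (hσ.mapsTo hb) _ (hσ.mapsTo hv), hbn] at hA
      have hv2 : σ v ≤ 2 := hS _ (by simpa using hA)
      rw [hbn, backPathPotential, backPathPotential, if_pos hv2, if_neg (by omega), zero_sub]
    · rfl
  have hdb : (outDeg n E b : ℝ) ≠ 0 := (Nat.cast_pos.mpr (hdeg b hb)).ne'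
  rw [hsb, hdega, ← mul_assoc, div_mul_cancel₀ _ hdb] at hdrift
  refine ⟨a, ha, b, hb, ?_⟩
  unfold maxRatio
  linarith

theorem exists_pratio_eq {n : ℕ} (hn : 1 ≤ n) (φ : ℕ → ℝ) :
    ∃ a ∈ Finset.Icc 1 n, ∃ b ∈ Finset.Icc 1 n, pratio n φ = φ a / φ b ∧
      ∀ u ∈ Finset.Icc 1 n, φ u ≤ φ a ∧ φ b ≤ φ u := by
  have hne : (Finset.Icc 1 n).Nonempty := ⟨1, by simp; omega⟩
  obtain ⟨a, ha, hmax⟩ := Finset.exists_mem_eq_sup' hne φ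
  obtain ⟨b, hb, hmin⟩ := Finset.exists_mem_eq_inf' hne φ
  refine ⟨a, ha, b, hb, by rw [pratio, dif_pos hne, hmax, hmin], fun u hu => ⟨?_, ?_⟩⟩
  · exact hmax ▸ Finset.le_sup' φ hu
  · exact hmin ▸ Finset.inf'_le φ hu

theorem IsPerron.pratio_le {n : ℕ} {E : ℕ → ℕ → Bool} {φ : ℕ → ℝ} (hn : 3 ≤ n)
    (hE : IsDigraph n E) (hS : StronglyConnected n E) (hφ : IsPerron n E φ) :
    pratio n φ ≤ maxRatio n := by
  obtain ⟨a, ha, b, hb, heq, -⟩ := exists_pratio_eq (n := n) (by omega) φ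
  have hφb := hφ.1 b hb
  rw [heq, div_le_iff₀ hφb]
  by_cases hab : a = b
  · subst hab
    nlinarith [two_le_maxRatio hn]
  · exact (hφ.le_maxRatio_mul hn hE hS ha hb hab).1

theorem IsPerron.pratio_eq_iff {n : ℕ} {E : ℕ → ℕ → Bool} {φ : ℕ → ℝ} (hn : 3 ≤ n)
    (hE : IsDigraph n E) (hS : StronglyConnected n E) (hφ : IsPerron n E φ) :
    pratio n φ = maxRatio n ↔ IsoTo n E (E1 n) ∨ IsoTo n E (E2 n) ∨ IsoTo n E (E3 n) := by
  obtain ⟨a, ha, b, hb, heq, hext⟩ := exists_pratio_eq (n := n) (by omega) φ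
  have hφb := hφ.1 b hb
  constructor
  · intro h
    rw [heq, div_eq_iff hφb.ne'] at h
    refine (hφ.le_maxRatio_mul hn hE hS ha hb ?_).2 h
    rintro rfl
    nlinarith [two_le_maxRatio hn]
  · intro h
    obtain ⟨c, hc, d, hd, hcd⟩ :
        ∃ a ∈ Finset.Icc 1 n, ∃ b ∈ Finset.Icc 1 n, φ a = maxRatio n * φ b := by
      rcases h with h | h | h
      · exact hφ.exists_ratio_eq hn hE hS h (isBackPath_E1 n) (by omega)
      · exact hφ.exists_ratio_eq hn hE hS h (isBackPath_E2 n) (by omega)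
      · exact hφ.exists_ratio_eq hn hE hS h (isBackPath_E3 n) (by omega)
    refine le_antisymm (hφ.pratio_le hn hE hS) ?_
    rw [heq, le_div_iff₀ hφb]
    nlinarith [(hext c hc).1, (hext d hd).2, two_le_maxRatio hn]

theorem isDigraph_E1 {n : ℕ} (hn : 2 ≤ n) : IsDigraph n (E1 n) := by
  intro u v h
  simp only [E1, decide_eq_true_eq] at h
  simp only [Finset.mem_Icc]
  omega

theorem walkLen_E1 {n u d : ℕ} (hu : 1 ≤ u) (hd : u + d ≤ n) : WalkLen (E1 n) d u (u + d) := by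
  induction d generalizing u with
  | zero => rfl
  | succ d ih =>
    refine ⟨u + 1, ?_, ?_⟩
    · exact decide_eq_true (Or.inl ⟨hu, by omega, rfl⟩)
    · rw [show u + (d + 1) = u + 1 + d by omega]
      exact ih (by omega) (by omega)

theorem stronglyConnected_E1 (n : ℕ) : StronglyConnected n (E1 n) := by
  intro u hu v hv
  rw [Finset.mem_Icc] at hu hv
  have h1 : WalkLen (E1 n) (n - u) u n := by
    simpa [Nat.add_sub_cancel' hu.2] using walkLen_E1 (n := n) (d := n - u) hu.1 (by omega)
  have h2 : WalkLen (E1 n) 1 n 1 := ⟨1, by simp [E1], rfl⟩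
  have h3 : WalkLen (E1 n) (v - 1) 1 v := by
    simpa [Nat.add_sub_cancel' hv.1] using walkLen_E1 (n := n) (d := v - 1) le_rfl (by omega)
  obtain ⟨m, hm⟩ := h1.trans h2
  exact hm.trans h3

theorem gammaN_eq_maxRatio {n : ℕ} (hn : 3 ≤ n) : gammaN n = maxRatio n := by
  have hE := isDigraph_E1 (n := n) (by omega)
  have hS := stronglyConnected_E1 n
  obtain ⟨φ, hφ⟩ := exists_perron (by omega) hE hS
  refine IsGreatest.csSup_eq ⟨⟨E1 n, φ, hE, hS, hφ, ?_⟩, ?_⟩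
  · exact ((hφ.pratio_eq_iff hn hE hS).mpr
      (Or.inl ⟨id, Set.bijOn_id _, fun _ _ _ _ => Iff.rfl⟩)).symm
  · rintro r ⟨E, ψ, hE', hS', hψ, rfl⟩
    exact hψ.pratio_le hn hE' hS'

theorem maxRatio_eq {n : ℕ} (hn : 3 ≤ n) :
    maxRatio n = (2/3 : ℝ) *
        ((n : ℝ) / ((n : ℝ) - 1) +
          (1 / (Nat.factorial (n - 1) : ℝ)) *
            ∑ i ∈ Finset.Icc 1 (n - 3), (Nat.factorial i : ℝ)) *
        (Nat.factorial (n - 1) : ℝ) := by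
  obtain ⟨m, rfl⟩ : ∃ m, n = m + 3 := ⟨n - 3, by omega⟩
  rw [maxRatio, show m + 3 - 1 = m + 1 + 1 by omega, Nat.add_sub_cancel, factSum_succ,
    factSum_succ, ← factSum, Nat.factorial_succ (m + 1)]
  have h1 : ((m + 1).factorial : ℝ) ≠ 0 := by positivity
  have h2 : (m : ℝ) + 1 + 1 ≠ 0 := by positivity
  have h3 : ((m + 3 : ℕ) : ℝ) - 1 = m + 1 + 1 := by push_cast; ring
  rw [h3]
  push_cast
  field_simp
  ring

theorem factSum_le_factorial_succ (m : ℕ) : factSum m ≤ (Nat.factorial (m + 1) : ℝ) := by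
  induction m with
  | zero => simp [factSum]
  | succ m ih =>
    rw [factSum_succ, Nat.factorial_succ (m + 1)]
    push_cast
    have : (0 : ℝ) ≤ (m + 1).factorial := by positivity
    nlinarith [(Nat.cast_nonneg m : (0 : ℝ) ≤ m)]

theorem tendsto_gammaN_div_factorial :
    Filter.Tendsto (fun n : ℕ => gammaN n / (Nat.factorial (n - 1) : ℝ))
      Filter.atTop (nhds (2/3 : ℝ)) := by
  rw [← Filter.tendsto_add_atTop_iff_nat 3]
  have hval : ∀ m : ℕ, gammaN (m + 3) / (Nat.factorial (m + 3 - 1) : ℝ) =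
      2 / 3 + 2 / 3 * (factSum (m + 1) / (Nat.factorial (m + 1 + 1) : ℝ)) := by
    intro m
    have h : ((m + 1 + 1).factorial : ℝ) ≠ 0 := by positivity
    rw [gammaN_eq_maxRatio (by omega), maxRatio, show m + 3 - 1 = m + 1 + 1 by omega,
      factSum_succ]
    field_simp
    ring
  have hlim : Filter.Tendsto (fun m : ℕ => factSum (m + 1) / (Nat.factorial (m + 1 + 1) : ℝ))
      Filter.atTop (nhds 0) := by
    have hzero : Filter.Tendsto (fun m : ℕ => 2 * (1 / ((m : ℝ) + 1))) Filter.atTop (nhds 0) := by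
      simpa using (tendsto_one_div_add_atTop_nhds_zero_nat (𝕜 := ℝ)).const_mul 2
    refine squeeze_zero (fun m => ?_) (fun m => ?_) hzero
    · exact div_nonneg (Finset.sum_nonneg fun i _ => by positivity) (by positivity)
    · rw [factSum_succ, Nat.factorial_succ (m + 1), mul_one_div, div_le_div_iff₀ (by positivity)
        (by positivity)]
      push_cast
      have hm : (0 : ℝ) ≤ m := Nat.cast_nonneg m
      have hf : (0 : ℝ) ≤ (m + 1).factorial := by positivity
      nlinarith [mul_le_mul_of_nonneg_right (factSum_le_factorial_succ m)
        (show (0 : ℝ) ≤ m + 1 by positivity)]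
  simp only [hval]
  simpa using (hlim.const_mul (2 / 3)).const_add (2 / 3)

/-- `γ(n) = (2/3)(n/(n-1) + (1/(n-1)!)∑_{i=1}^{n-3} i!)(n-1)!`, the maximum is
attained exactly by the graphs isomorphic to `D₁`, `D₂`, or `D₃`, and
`γ(n)/(n-1)! → 2/3`. -/
theorem stmt18 :
    (∀ n : ℕ, 3 ≤ n →
      gammaN n = (2/3 : ℝ) *
        ((n : ℝ) / ((n : ℝ) - 1) +
          (1 / (Nat.factorial (n - 1) : ℝ)) *
            ∑ i ∈ Finset.Icc 1 (n - 3), (Nat.factorial i : ℝ)) *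
        (Nat.factorial (n - 1) : ℝ) ∧
      (∀ E : ℕ → ℕ → Bool, ∀ φ : ℕ → ℝ,
        IsDigraph n E → StronglyConnected n E → IsPerron n E φ →
        (pratio n φ = gammaN n ↔
          (IsoTo n E (E1 n) ∨ IsoTo n E (E2 n) ∨ IsoTo n E (E3 n))))) ∧
    Filter.Tendsto (fun n : ℕ => gammaN n / (Nat.factorial (n - 1) : ℝ))
      Filter.atTop (nhds (2/3 : ℝ)) := by
  refine ⟨fun n hn => ⟨(gammaN_eq_maxRatio hn).trans (maxRatio_eq hn), ?_⟩,
    tendsto_gammaN_div_factorial⟩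
  intro E φ hE hS hφ
  rw [gammaN_eq_maxRatio hn]
  exact hφ.pratio_eq_iff hn hE hS

end PR
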